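/- For every integer k ≥ 1 and n = 2k+1, there exists a strategyproof mechanism M : (Fin n → C) → PMF C such that for every profile b : Fin n → C and every point w ∈ C, sc_b(M b) ≤ (7/4) · sc_b(w). (Equivalently, the approximation ratio of M with respect to the minimal social cost is at most 7/4 on every profile.) -/

import Mathlib

open MeasureTheory

noncomputable section

/-- The cycle of circumference 1. -/
abbrev Cyc : Type := AddCircle (1 : ℝ)

/-- Cost of a lottery `l` to an agent with ideal point `v`. -/
def cost (v : Cyc) (l : PMF Cyc) : ℝ := ∫ x, dist v x ∂ l.toMeasure

/-- Social cost of a lottery `l` at profile `b`. -/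
def scLot {n : ℕ} (b : Fin n → Cyc) (l : PMF Cyc) : ℝ := ∑ i, cost (b i) l

/-- Social cost of a point `w` at profile `b`. -/
def scPt {n : ℕ} (b : Fin n → Cyc) (w : Cyc) : ℝ := ∑ i, dist (b i) w

/-- Strategyproofness of a mechanism. -/
def Strategyproof {n : ℕ} (M : (Fin n → Cyc) → PMF Cyc) : Prop :=
  ∀ (b : Fin n → Cyc) (i : Fin n) (v : Cyc),
    cost (b i) (M b) ≤ cost (b i) (M (Function.update b i v))

/-! ### Coordinates on the circle -/

/-- Representative of a point of the circle in `[0,1)`. -/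
def fr (c : Cyc) : ℝ := (AddCircle.equivIco (1 : ℝ) 0 c : ℝ)

lemma fr_nonneg (c : Cyc) : 0 ≤ fr c := (AddCircle.equivIco (1 : ℝ) 0 c).2.1

lemma fr_lt_one (c : Cyc) : fr c < 1 := by
  have := (AddCircle.equivIco (1 : ℝ) 0 c).2.2
  simpa [fr] using this

lemma coe_fr (c : Cyc) : ((fr c : ℝ) : Cyc) = c := AddCircle.coe_equivIco

lemma fr_coe {x : ℝ} (h0 : 0 ≤ x) (h1 : x < 1) : fr (x : Cyc) = x := by
  unfold fr
  rw [AddCircle.coe_equivIco_mk_apply]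
  simp [Int.fract_eq_self.2 ⟨h0, h1⟩]

lemma coe_sub_one (x : ℝ) : ((x - 1 : ℝ) : Cyc) = (x : Cyc) := by
  have h : ((1 : ℝ) : Cyc) = 0 := AddCircle.coe_period 1
  rw [AddCircle.coe_sub, h, sub_zero]

lemma measurable_fr : Measurable fr :=
  measurable_subtype_coe.comp (AddCircle.measurableEquivIco (1 : ℝ) 0).measurable

/-- Distance to `0` in coordinates. -/
def psi (x : ℝ) : ℝ := min x (1 - x)

lemma norm_coe {x : ℝ} (h0 : 0 ≤ x) (h1 : x ≤ 1) : ‖(x : Cyc)‖ = psi x := by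
  unfold psi
  rcases le_total x (1 / 2) with h | h
  · have : ‖(x : Cyc)‖ = |x| := (AddCircle.norm_coe_eq_abs_iff (1 : ℝ) one_ne_zero).2 (by
      rw [abs_of_nonneg h0]; simpa using h)
    rw [this, abs_of_nonneg h0, min_eq_left (by linarith)]
  · have : ‖((x - 1 : ℝ) : Cyc)‖ = |x - 1| :=
      (AddCircle.norm_coe_eq_abs_iff (1 : ℝ) one_ne_zero).2 (by
        rw [abs_of_nonpos (by linarith)]; simp; linarith)
    rw [← coe_sub_one, this, abs_of_nonpos (by linarith), min_eq_right (by linarith)]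
    ring

lemma norm_coe_neg {x : ℝ} (h0 : -1 ≤ x) (h1 : x ≤ 0) : ‖(x : Cyc)‖ = psi (x + 1) := by
  have := norm_coe (x := x + 1) (by linarith) (by linarith)
  rw [← this, ← coe_sub_one (x + 1)]
  simp

lemma norm_coe_le (x : ℝ) : ‖(x : Cyc)‖ ≤ |x| := by
  exact QuotientAddGroup.norm_mk_le_norm

/-- Slope of `psi`. -/
def sig (u : ℝ) : ℝ := if u < 1 / 2 then 1 else -1

lemma sig_anti {u t : ℝ} (h : u ≤ t) : sig t ≤ sig u := by
  unfold sig; split_ifs <;> linarith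

lemma measurable_sig : Measurable sig :=
  Measurable.ite measurableSet_Iio measurable_const measurable_const

lemma abs_sig_le (u : ℝ) : |sig u| ≤ 1 := by
  unfold sig; split_ifs <;> simp

lemma intervalIntegrable_sig (a b : ℝ) : IntervalIntegrable sig volume a b := by
  refine (intervalIntegrable_const (c := (1 : ℝ))).mono_fun
    measurable_sig.aestronglyMeasurable (Filter.Eventually.of_forall fun u => ?_)
  simpa using abs_sig_le u

lemma integral_sig_left {a b : ℝ} (hab : a ≤ b) (hb : b ≤ 1 / 2) :
    ∫ u in a..b, sig u = b - a := by
  rw [intervalIntegral.integral_congr_ae (g := fun _ => (1 : ℝ))]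
  · simp
  · have : ∀ᵐ u : ℝ, u ≠ 1 / 2 := by simp [ae_iff]
    filter_upwards [this] with u hu h
    rw [Set.uIoc_of_le hab] at h
    have : u < 1 / 2 := lt_of_le_of_ne (h.2.trans hb) hu
    simp only [sig, if_pos this]

lemma integral_sig_right {a b : ℝ} (hab : a ≤ b) (hb : 1 / 2 ≤ a) :
    ∫ u in a..b, sig u = a - b := by
  rw [intervalIntegral.integral_congr_ae (g := fun _ => (-1 : ℝ))]
  · simp
  · refine Filter.Eventually.of_forall fun u h => ?_
    rw [Set.uIoc_of_le hab] at h
    have : ¬ u < 1 / 2 := not_lt.2 (hb.trans h.1.le)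
    simp only [sig, if_neg this]

lemma integral_sig {a b : ℝ} (hab : a ≤ b) :
    ∫ u in a..b, sig u = psi b - psi a := by
  unfold psi
  rcases le_total b (1 / 2) with h | h
  · rw [integral_sig_left hab h, min_eq_left (by linarith), min_eq_left (by linarith)]
  rcases le_total a (1 / 2) with h' | h'
  · rw [← intervalIntegral.integral_add_adjacent_intervals (b := 1 / 2)
      (intervalIntegrable_sig _ _) (intervalIntegrable_sig _ _),
      integral_sig_left h' le_rfl, integral_sig_right h le_rfl,
      min_eq_right (by linarith), min_eq_left (by linarith)]
    ring
  · rw [integral_sig_right hab h', min_eq_right (by linarith), min_eq_right (by linarith)]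
    ring

/-! ### Medians -/

/-- `m` is a median of the `2k+1` numbers `z j`. -/
def IsMed {n : ℕ} (k : ℕ) (z : Fin n → ℝ) (m : ℝ) : Prop :=
  (Finset.univ.filter fun j => z j < m).card ≤ k ∧
    k + 1 ≤ (Finset.univ.filter fun j => z j ≤ m).card

lemma exists_isMed {n k : ℕ} (hkn : k < n) (z : Fin n → ℝ) : ∃ i, IsMed k z (z i) := by
  have hne : (Finset.univ.filter fun i : Fin n =>
      k + 1 ≤ (Finset.univ.filter fun j => z j ≤ z i).card).Nonempty := by
    have : Nonempty (Fin n) := ⟨⟨k, hkn⟩⟩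
    obtain ⟨i, -, hi⟩ := Finset.exists_max_image Finset.univ z Finset.univ_nonempty
    refine ⟨i, ?_⟩
    have h : (Finset.univ.filter fun j => z j ≤ z i) = Finset.univ :=
      Finset.filter_true_of_mem hi
    simp only [Finset.mem_filter, Finset.mem_univ, true_and]
    rw [h]; simpa using hkn
  obtain ⟨i, hi, hmin⟩ := Finset.exists_min_image _ z hne
  simp only [Finset.mem_filter, Finset.mem_univ, true_and] at hi hmin
  refine ⟨i, ?_, hi⟩
  by_contra hcon
  push Not at hcon
  have hne2 : (Finset.univ.filter fun j => z j < z i).Nonempty := by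
    rw [← Finset.card_pos]; omega
  obtain ⟨l, hl, hmax⟩ := Finset.exists_max_image _ z hne2
  simp only [Finset.mem_filter, Finset.mem_univ, true_and] at hl hmax
  have := hmin l (hcon.trans_le (Finset.card_le_card fun j hj => by
    simp only [Finset.mem_filter, Finset.mem_univ, true_and] at hj ⊢
    exact hmax j hj))
  linarith

lemma IsMed.shift {n k : ℕ} {z : Fin n → ℝ} {m : ℝ} (c : ℝ)
    (h : IsMed k (fun j => z j + c) (m + c)) : IsMed k z m := by
  simpa [IsMed] using h

lemma card_split {n : ℕ} (i : Fin n) (p : Fin n → Prop) [DecidablePred p] :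
    (Finset.univ.filter p).card =
      (Finset.univ.filter fun j => j ≠ i ∧ p j).card + if p i then 1 else 0 := by
  have h : (Finset.univ.filter fun j => j ≠ i ∧ p j) = (Finset.univ.filter p).erase i := by
    ext j; simp
  rw [h]
  split_ifs with hp
  · rw [Finset.card_erase_add_one (by simpa using hp)]
  · rw [Finset.erase_eq_of_notMem (by simpa using hp)]; rfl

lemma card_mono {n : ℕ} {p q : Fin n → Prop} [DecidablePred p] [DecidablePred q]
    (h : ∀ j, p j → q j) : (Finset.univ.filter p).card ≤ (Finset.univ.filter q).card :=
  Finset.card_le_card fun j hj => by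
    simp only [Finset.mem_filter, Finset.mem_univ, true_and] at hj ⊢; exact h j hj

lemma med_update {n k : ℕ} {z z' : Fin n → ℝ} {i : Fin n} (heq : ∀ j, j ≠ i → z' j = z j)
    {m m' : ℝ} (hlt : z i < z' i) (hm : IsMed k z m) (hm' : IsMed k z' m') :
    (m = m' ∨ (z i ≤ m ∧ m ≤ m' ∧ m' ≤ z' i)) ∧
    ∀ u, z i < u → u < z' i →
      (((Finset.univ.filter fun j => j ≠ i ∧ z j < u).card = k → m ≤ u ∧ u ≤ m') ∧
        (m < u → u < m' → (Finset.univ.filter fun j => j ≠ i ∧ z j < u).card = k)) := by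
  have e1 : ∀ u, (Finset.univ.filter fun j => z j < u).card =
      (Finset.univ.filter fun j => j ≠ i ∧ z j < u).card + if z i < u then 1 else 0 :=
    fun u => card_split i _
  have e2 : ∀ u, (Finset.univ.filter fun j => z j ≤ u).card =
      (Finset.univ.filter fun j => j ≠ i ∧ z j ≤ u).card + if z i ≤ u then 1 else 0 :=
    fun u => card_split i _
  have e3 : ∀ u, (Finset.univ.filter fun j => z' j < u).card =
      (Finset.univ.filter fun j => j ≠ i ∧ z j < u).card + if z' i < u then 1 else 0 := by
    intro u
    rw [card_split i]
    congr 2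
    ext j
    simp only [Finset.mem_filter, Finset.mem_univ, true_and]
    exact and_congr_right fun hj => by rw [heq j hj]
  have e4 : ∀ u, (Finset.univ.filter fun j => z' j ≤ u).card =
      (Finset.univ.filter fun j => j ≠ i ∧ z j ≤ u).card + if z' i ≤ u then 1 else 0 := by
    intro u
    rw [card_split i]
    congr 2
    ext j
    simp only [Finset.mem_filter, Finset.mem_univ, true_and]
    exact and_congr_right fun hj => by rw [heq j hj]
  have mono : ∀ u v, u < v → (Finset.univ.filter fun j => j ≠ i ∧ z j ≤ u).card ≤
      (Finset.univ.filter fun j => j ≠ i ∧ z j < v).card :=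
    fun u v huv => card_mono fun j hj => ⟨hj.1, hj.2.trans_lt huv⟩
  have mono2 : ∀ u v, u ≤ v → (Finset.univ.filter fun j => j ≠ i ∧ z j < u).card ≤
      (Finset.univ.filter fun j => j ≠ i ∧ z j < v).card :=
    fun u v huv => card_mono fun j hj => ⟨hj.1, hj.2.trans_le huv⟩
  obtain ⟨h1, h2⟩ := hm
  obtain ⟨h3, h4⟩ := hm'
  rw [e1] at h1
  rw [e2] at h2
  rw [e3] at h3
  rw [e4] at h4
  refine ⟨?_, fun u hu hu' => ⟨fun hc => ⟨?_, ?_⟩, fun hmu hum => ?_⟩⟩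
  · rcases lt_trichotomy m m' with h | h | h
    · right
      have := mono m m' h
      refine ⟨?_, h.le, ?_⟩
      · by_contra hc
        rw [if_neg hc] at h2
        omega
      · by_contra hc
        rw [if_pos (not_le.1 hc)] at h3
        split_ifs at h2
        all_goals omega
    · exact Or.inl h
    · exfalso
      have := mono m' m h
      by_cases hc : z' i ≤ m'
      · rw [if_pos (hlt.trans (hc.trans_lt h))] at h1
        split_ifs at h4
        omega
      · rw [if_neg hc] at h4
        omega
  · by_contra hcon
    push Not at hcon
    have := mono2 u m hcon.le
    rw [if_pos (hu.trans hcon)] at h1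
    omega
  · by_contra hcon
    push Not at hcon
    have := mono m' u hcon
    rw [if_neg (by linarith)] at h4
    omega
  · have a1 := mono m u hmu
    have a2 := mono2 u m' hum.le
    split_ifs at h2
    all_goals omega

/-- Position on the line obtained by cutting the circle at `t`. -/
def zf {n : ℕ} (y : Fin n → ℝ) (t : ℝ) (j : Fin n) : ℝ := if y j < t then y j else y j - 1

lemma fr_sub_cut (c v : Cyc) {t : ℝ} (h0 : 0 < t) (h1 : t < 1) :
    fr (c - (v + (t : Cyc))) =
      (if fr (c - v) < t then fr (c - v) else fr (c - v) - 1) + (1 - t) := by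
  have a := fr_nonneg (c - v)
  have b := fr_lt_one (c - v)
  have e : c - (v + (t : Cyc)) = ((fr (c - v) - t : ℝ) : Cyc) := by
    rw [AddCircle.coe_sub, coe_fr]
    abel
  rw [e]
  split_ifs with h
  · have : ((fr (c - v) - t : ℝ) : Cyc) = ((fr (c - v) + (1 - t) : ℝ) : Cyc) := by
      rw [← coe_sub_one (fr (c - v) + (1 - t))]
      congr 1; ring
    rw [this, fr_coe (by linarith) (by linarith)]
  · rw [fr_coe (by linarith) (by linarith)]; ring

/-! ### The mechanism -/

/-- A choice of index satisfying a predicate. -/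
def pick {n : ℕ} [NeZero n] (S : Fin n → Prop) : Fin n :=
  open Classical in if h : ∃ i, S i then h.choose else 0

/-- Index of the median agent when the circle is cut at `t`. -/
def idx {k : ℕ} (b : Fin (2 * k + 1) → Cyc) (t : Cyc) : Fin (2 * k + 1) :=
  pick fun i => IsMed k (fun j => fr (b j - t)) (fr (b i - t))

lemma idx_spec {k : ℕ} (b : Fin (2 * k + 1) → Cyc) (t : Cyc) :
    IsMed k (fun j => fr (b j - t)) (fr (b (idx b t) - t)) := by
  have h : ∃ i, IsMed k (fun j => fr (b j - t)) (fr (b i - t)) :=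
    exists_isMed (by omega) (fun j => fr (b j - t))
  unfold idx pick
  rw [dif_pos h]
  exact h.choose_spec

lemma measurable_card {α : Type*} [MeasurableSpace α] {n : ℕ} (p : α → Fin n → Prop)
    [∀ a, DecidablePred (p a)] (h : ∀ j, MeasurableSet {a | p a j}) :
    Measurable fun a => (Finset.univ.filter (p a)).card := by
  simp only [Finset.card_filter]
  refine Finset.measurable_sum _ fun j _ => ?_
  exact Measurable.ite (h j) measurable_const measurable_const

lemma measurable_idx {k : ℕ} (b : Fin (2 * k + 1) → Cyc) : Measurable (idx b) := by
  have hfr : ∀ j, Measurable fun t : Cyc => fr (b j - t) := fun j =>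
    measurable_fr.comp (measurable_const.sub measurable_id)
  have h : Measurable fun t : Cyc => fun i =>
      IsMed k (fun j => fr (b j - t)) (fr (b i - t)) := by
    refine measurable_pi_lambda _ fun i => ?_
    refine measurableSet_setOfPred.1 ?_
    unfold IsMed
    refine MeasurableSet.inter ?_ ?_
    · exact measurableSet_le (measurable_card _ fun j => measurableSet_lt (hfr j) (hfr i))
        measurable_const
    · exact measurableSet_le measurable_const
        (measurable_card _ fun j => measurableSet_le (hfr j) (hfr i))
  exact (measurable_of_finite (pick (n := 2 * k + 1))).comp h

/-- Cutting at `v + t`, in coordinates based at `v`. -/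
lemma idx_coord {k : ℕ} (b : Fin (2 * k + 1) → Cyc) (v : Cyc) {t : ℝ} (h0 : 0 < t) (h1 : t < 1) :
    ∃ m : ℝ, IsMed k (zf (fun j => fr (b j - v)) t) m ∧
      b (idx b (v + (t : Cyc))) - v = (m : Cyc) := by
  have h := idx_spec b (v + (t : Cyc))
  simp only [fr_sub_cut _ v h0 h1] at h
  refine ⟨_, h.shift (1 - t), ?_⟩
  split_ifs
  · rw [coe_fr]
  · rw [coe_sub_one, coe_fr]

/-- Expectation of `f` under the random median mechanism. -/
def pcd {k : ℕ} (b : Fin (2 * k + 1) → Cyc) (f : Cyc → ℝ) : ℝ := ∫ t : Cyc, f (b (idx b t))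

lemma pcd_eq {k : ℕ} (b : Fin (2 * k + 1) → Cyc) (f : Cyc → ℝ) (v : Cyc) :
    pcd b f = ∫ t in (0 : ℝ)..1, f (b (idx b (v + (t : Cyc)))) := by
  have h := AddCircle.intervalIntegral_preimage (1 : ℝ) 0 (fun t : Cyc => f (b (idx b (v + t))))
  rw [zero_add] at h
  rw [h, pcd]
  exact (integral_add_left_eq_self (fun t : Cyc => f (b (idx b t))) v).symm

lemma pcd_ii {k : ℕ} (b : Fin (2 * k + 1) → Cyc) (f : Cyc → ℝ) (v : Cyc) (x y : ℝ) :
    IntervalIntegrable (fun t : ℝ => f (b (idx b (v + (t : Cyc))))) volume x y := by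
  have hm : Measurable (fun t : ℝ => f (b (idx b (v + (t : Cyc))))) :=
    (measurable_of_finite (fun i => f (b i))).comp ((measurable_idx b).comp
      (measurable_const.add AddCircle.measurable_mk'))
  refine (intervalIntegrable_const (c := ∑ i, ‖f (b i)‖)).mono_fun
    hm.aestronglyMeasurable (Filter.Eventually.of_forall fun u => ?_)
  refine le_trans ?_ (le_abs_self _)
  exact Finset.single_le_sum (f := fun i => ‖f (b i)‖) (fun i _ => norm_nonneg _)
    (Finset.mem_univ (idx b (v + (u : Cyc))))

/-- The distribution over agents. -/
def mixMeasure {k : ℕ} (b : Fin (2 * k + 1) → Cyc) : Measure (Fin (2 * k + 1)) :=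
  (2⁻¹ : ENNReal) • (PMF.uniformOfFintype (Fin (2 * k + 1))).toMeasure +
    (2⁻¹ : ENNReal) • (volume : Measure Cyc).map (idx b)

instance {k : ℕ} (b : Fin (2 * k + 1) → Cyc) : IsProbabilityMeasure (mixMeasure b) := by
  constructor
  simp only [mixMeasure, Measure.add_apply, Measure.smul_apply, measure_univ, smul_eq_mul, mul_one]
  rw [Measure.map_apply (measurable_idx b) MeasurableSet.univ]
  simp [ENNReal.inv_two_add_inv_two]

/-- The mechanism: half random dictator, half random cut median. -/
def mech {k : ℕ} (b : Fin (2 * k + 1) → Cyc) : PMF Cyc := (mixMeasure b).toPMF.map b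

lemma cost_mech {k : ℕ} (b : Fin (2 * k + 1) → Cyc) (v : Cyc) :
    cost v (mech b) = 1 / 2 * (1 / (2 * k + 1) * ∑ j, dist v (b j)) +
      1 / 2 * pcd b (fun x => dist v x) := by
  have hb : Measurable b := measurable_of_finite b
  unfold cost mech
  rw [← PMF.toMeasure_map (hf := hb), Measure.toPMF_toMeasure,
    integral_map hb.aemeasurable (by fun_prop)]
  unfold mixMeasure
  have hfin : IsFiniteMeasure ((volume : Measure Cyc).map (idx b)) :=
    Measure.isFiniteMeasure_map _ _
  rw [integral_add_measure (Integrable.of_finite.smul_measure (by simp))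
      (Integrable.smul_measure (@Integrable.of_finite _ _ _ _ _ _ _ hfin _) (by simp)), integral_smul_measure, integral_smul_measure,
    integral_map (measurable_idx b).aemeasurable
      (measurable_of_finite _).aestronglyMeasurable, PMF.integral_eq_sum]
  simp only [PMF.uniformOfFintype_apply, pcd, ENNReal.toReal_inv, ENNReal.toReal_natCast,
    Fintype.card_fin]
  simp [Finset.mul_sum]

/-! ### Strategyproofness -/

lemma integral_between (g : ℝ → ℝ) (Q : ℝ → Prop) [DecidablePred Q] {a a' m m' : ℝ}
    (haa : a ≤ a') (hm : m = m' ∨ (a ≤ m ∧ m ≤ m' ∧ m' ≤ a'))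
    (h : ∀ u, a < u → u < a' → ((Q u → m ≤ u ∧ u ≤ m') ∧ (m < u → u < m' → Q u))) :
    ∫ u in a..a', g u * (if Q u then 1 else 0) = ∫ u in m..m', g u := by
  have hmm : m ≤ m' := by rcases hm with h | h; exacts [h.le, h.2.1]
  rw [intervalIntegral.integral_of_le haa, intervalIntegral.integral_of_le hmm]
  have hsub : Set.Ioc a a' ∩ Set.Ioc m m' = Set.Ioc m m' := by
    rcases hm with h | h
    · simp [h]
    · exact Set.inter_eq_right.2 (Set.Ioc_subset_Ioc h.1 h.2.2)
  have hne : ∀ c : ℝ, ∀ᵐ u : ℝ, u ≠ c := fun c => by simp [ae_iff]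
  rw [← hsub, ← setIntegral_indicator measurableSet_Ioc]
  refine setIntegral_congr_ae measurableSet_Ioc ?_
  filter_upwards [hne a', hne m, hne m'] with u h1 h2 h3 hu
  have hq := h u hu.1 (lt_of_le_of_ne hu.2 h1)
  by_cases hmu : u ∈ Set.Ioc m m'
  · rw [Set.indicator_of_mem hmu, if_pos (hq.2 hmu.1 (lt_of_le_of_ne hmu.2 h3)), mul_one]
  · rw [Set.indicator_of_notMem hmu, if_neg, mul_zero]
    intro hQ
    have := hq.1 hQ
    exact hmu ⟨lt_of_le_of_ne this.1 (Ne.symm h2), this.2⟩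

/-- Number of agents other than `i` strictly below `u`. -/
def cntN {n : ℕ} (y : Fin n → ℝ) (i : Fin n) (u : ℝ) : ℕ :=
  (Finset.univ.filter fun j => j ≠ i ∧ y j < u).card

lemma cntN_mono {n : ℕ} (y : Fin n → ℝ) (i : Fin n) : Monotone (cntN y i) :=
  fun _ _ h => card_mono fun _ hj => ⟨hj.1, hj.2.trans_le h⟩

lemma cntN_add {n : ℕ} (y : Fin n → ℝ) (i : Fin n) (u : ℝ) :
    cntN y i u + (Finset.univ.filter fun j => j ≠ i ∧ ¬ y j < u).card + 1 = n := by
  have h1 := card_split i (fun _ => True)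
  have h2 := Finset.card_filter_add_card_filter_not (s := Finset.univ.filter fun j => j ≠ i)
    (fun j => y j < u)
  rw [Finset.filter_filter, Finset.filter_filter] at h2
  simp only [and_true, if_true, Finset.filter_true, Finset.card_univ, Fintype.card_fin] at h1
  unfold cntN
  omega

/-- `t` and `u` separate the other agents evenly. -/
def SepEv (k : ℕ) (N : ℝ → ℕ) (t u : ℝ) : Prop := N t = N u + k ∨ N u = N t + k

instance (k : ℕ) (N : ℝ → ℕ) (t : ℝ) : DecidablePred (SepEv k N t) := fun u => by
  unfold SepEv; infer_instance

lemma sep_comm {k : ℕ} {N : ℝ → ℕ} {t u : ℝ} : SepEv k N t u ↔ SepEv k N u t := by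
  unfold SepEv; exact or_comm

lemma cut_right {k : ℕ} (hk : 1 ≤ k) {y y' : Fin (2 * k + 1) → ℝ} {i : Fin (2 * k + 1)}
    (heq : ∀ j, j ≠ i → y' j = y j) (hy : ∀ j, y j < 1) (hyi : y i = 0)
    {t : ℝ} (h0 : 0 < y' i) (hst : y' i < t) (ht : t < 1) {m m' : ℝ}
    (hm : IsMed k (zf y t) m) (hm' : IsMed k (zf y' t) m') :
    ‖(m' : Cyc)‖ - ‖(m : Cyc)‖ =
      ∫ u in (0 : ℝ)..(y' i), sig u * (if SepEv k (cntN y i) t u then 1 else 0) := by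
  have zi : zf y t i = 0 := by unfold zf; rw [hyi, if_pos (h0.trans hst)]
  have zi' : zf y' t i = y' i := by unfold zf; rw [if_pos hst]
  obtain ⟨hA, hB⟩ := med_update (z := zf y t) (z' := zf y' t) (i := i)
    (fun j hj => by unfold zf; rw [heq j hj]) (by rw [zi, zi']; exact h0) hm hm'
  rw [zi, zi'] at hA hB
  rw [integral_between sig (SepEv k (cntN y i) t) h0.le hA]
  · rcases hA with h | ⟨h1, h2, h3⟩
    · simp [h]
    · rw [integral_sig h2, norm_coe h1 (by linarith), norm_coe (by linarith) (by linarith)]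
  · intro u hu0 hu1
    have key : SepEv k (cntN y i) t u ↔
        (Finset.univ.filter fun j => j ≠ i ∧ zf y t j < u).card = k := by
      have e : (Finset.univ.filter fun j => j ≠ i ∧ zf y t j < u).card =
          cntN y i u + (Finset.univ.filter fun j => j ≠ i ∧ ¬ y j < t).card := by
        unfold cntN
        rw [← Finset.card_union_of_disjoint]
        · congr 1
          ext j
          simp only [Finset.mem_filter, Finset.mem_univ, true_and, Finset.mem_union]
          unfold zf
          have := hy j
          by_cases hj : y j < t
          · simp [hj]
          · simp only [hj, if_false, not_false_iff, and_true]
            constructor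
            · exact fun h => Or.inr h.1
            · rintro (h | h)
              · exact absurd (h.2.trans (hu1.trans hst)) hj
              · exact ⟨h, by linarith⟩
        · rw [Finset.disjoint_filter]
          rintro j - h1 h2
          exact h2.2 (h1.2.trans (hu1.trans hst))
      have e2 := cntN_add y i t
      have e3 := cntN_mono y i (hu1.trans hst).le
      rw [e]
      unfold SepEv
      omega
    rw [key]
    exact hB u hu0 hu1

lemma cut_left {k : ℕ} (hk : 1 ≤ k) {y y' : Fin (2 * k + 1) → ℝ} {i : Fin (2 * k + 1)}
    (heq : ∀ j, j ≠ i → y' j = y j) (hy0 : ∀ j, 0 ≤ y j) (hyi : y i = 0)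
    {t : ℝ} (h0 : 0 < t) (hst : t < y' i) (ht : y' i < 1) {m m' : ℝ}
    (hm : IsMed k (zf y t) m) (hm' : IsMed k (zf y' t) m') :
    ‖(m' : Cyc)‖ - ‖(m : Cyc)‖ =
      - ∫ u in (y' i)..1, sig u * (if SepEv k (cntN y i) t u then 1 else 0) := by
  have zi : zf y t i = 0 := by unfold zf; rw [hyi, if_pos h0]
  have zi' : zf y' t i = y' i - 1 := by unfold zf; rw [if_neg (not_lt.2 hst.le)]
  obtain ⟨hA, hB⟩ := med_update (z := zf y' t) (z' := zf y t) (i := i)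
    (fun j hj => by unfold zf; rw [heq j hj]) (by rw [zi, zi']; linarith) hm' hm
  rw [zi, zi'] at hA hB
  have hshift := intervalIntegral.integral_comp_add_right (a := y' i - 1) (b := 0)
    (fun u => sig u * (if SepEv k (cntN y i) t u then (1 : ℝ) else 0)) 1
  rw [sub_add_cancel, zero_add] at hshift
  rw [← hshift]
  rw [integral_between (fun u => sig (u + 1)) (fun u => SepEv k (cntN y i) t (u + 1))
    (by linarith) hA]
  · rw [intervalIntegral.integral_comp_add_right (fun u => sig u)]
    rcases hA with h | ⟨h1, h2, h3⟩
    · simp [h]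
    · rw [integral_sig (by linarith), norm_coe_neg (by linarith) (by linarith),
        norm_coe_neg (by linarith) (by linarith)]
      ring
  · intro u hu0 hu1
    have key : SepEv k (cntN y i) t (u + 1) ↔
        (Finset.univ.filter fun j => j ≠ i ∧ zf y' t j < u).card = k := by
      have e : cntN y i (u + 1) = (Finset.univ.filter fun j => j ≠ i ∧ zf y' t j < u).card +
          cntN y i t := by
        unfold cntN
        rw [← Finset.card_union_of_disjoint]
        · congr 1
          ext j
          simp only [Finset.mem_filter, Finset.mem_univ, true_and, Finset.mem_union]
          unfold zf
          have := hy0 j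
          by_cases hji : j = i
          · simp [hji]
          rw [heq j hji]
          by_cases hj : y j < t
          · rw [if_pos hj]
            constructor
            · exact fun _ => Or.inr ⟨hji, hj⟩
            · exact fun _ => ⟨hji, by linarith⟩
          · rw [if_neg hj]
            constructor
            · exact fun h => Or.inl ⟨hji, by linarith [h.2]⟩
            · rintro (h | h)
              exacts [⟨hji, by linarith [h.2]⟩, absurd h.2 hj]
        · rw [Finset.disjoint_filter]
          rintro j - h1 h2
          have h3 := h1.2
          unfold zf at h3
          rw [heq j h1.1, if_pos h2.2] at h3
          linarith [hy0 j]
      unfold SepEv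
      rw [e]
      omega
    rw [key]
    exact hB u hu0 hu1

lemma measurable_sep {k : ℕ} {N : ℝ → ℕ} (hN : Measurable N) :
    Measurable fun p : ℝ × ℝ => if SepEv k N p.1 p.2 then (1 : ℝ) else 0 := by
  have h1 : Measurable fun p : ℝ × ℝ => (N p.1, N p.2) :=
    (hN.comp measurable_fst).prodMk (hN.comp measurable_snd)
  have : (fun p : ℝ × ℝ => if SepEv k N p.1 p.2 then (1 : ℝ) else 0) =
      (fun q : ℕ × ℕ => if q.1 = q.2 + k ∨ q.2 = q.1 + k then (1 : ℝ) else 0) ∘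
        fun p : ℝ × ℝ => (N p.1, N p.2) := by
    ext p; simp only [Function.comp, SepEv]
  rw [this]
  exact (Measurable.of_discrete).comp h1

/-- The exchange argument. -/
lemma exchange {k : ℕ} {N : ℝ → ℕ} (hN : Measurable N) {s : ℝ} (h0 : 0 ≤ s) (h1 : s ≤ 1)
    {h : ℝ → ℝ} (hi : ∀ x y, IntervalIntegrable h volume x y)
    (hr : ∀ t, s < t → t < 1 →
      h t = ∫ u in (0 : ℝ)..s, sig u * (if SepEv k N t u then 1 else 0))
    (hl : ∀ t, 0 < t → t < s →
      h t = - ∫ u in s..1, sig u * (if SepEv k N t u then 1 else 0)) :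
    0 ≤ ∫ t in (0 : ℝ)..1, h t := by
  have hne : ∀ c : ℝ, ∀ᵐ u : ℝ, u ≠ c := fun c => by simp [ae_iff]
  rw [← intervalIntegral.integral_add_adjacent_intervals (hi 0 s) (hi s 1)]
  have e1 : ∫ t in (0 : ℝ)..s, h t =
      - ∫ t in Set.Ioc 0 s, ∫ u in Set.Ioc s 1, sig u * (if SepEv k N t u then 1 else 0) := by
    rw [intervalIntegral.integral_of_le h0, ← integral_neg]
    refine setIntegral_congr_ae measurableSet_Ioc ?_
    filter_upwards [hne s] with t ht htm
    rw [hl t htm.1 (lt_of_le_of_ne htm.2 ht), intervalIntegral.integral_of_le h1]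
  have e2 : ∫ t in s..1, h t =
      ∫ t in Set.Ioc s 1, ∫ u in Set.Ioc 0 s, sig u * (if SepEv k N t u then 1 else 0) := by
    rw [intervalIntegral.integral_of_le h1]
    refine setIntegral_congr_ae measurableSet_Ioc ?_
    filter_upwards [hne 1] with t ht htm
    rw [hr t htm.1 (lt_of_le_of_ne htm.2 ht), intervalIntegral.integral_of_le h0]
  have bdd : ∀ (μ : Measure (ℝ × ℝ)) [IsFiniteMeasure μ] (f : ℝ × ℝ → ℝ), Measurable f →
      (∀ p, |f p| ≤ 1) → Integrable f μ := fun μ _ f hf hb =>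
    Integrable.of_bound hf.aestronglyMeasurable 1 (Filter.Eventually.of_forall hb)
  have habs : ∀ x t u, |sig x * (if SepEv k N t u then (1 : ℝ) else 0)| ≤ 1 := by
    intro x t u
    split_ifs
    · simpa using abs_sig_le x
    · simp
  have i1 : Integrable (Function.uncurry fun t u => sig u * (if SepEv k N t u then (1 : ℝ) else 0))
      ((volume.restrict (Set.Ioc 0 s)).prod (volume.restrict (Set.Ioc s 1))) :=
    bdd _ _ ((measurable_sig.comp measurable_snd).mul (measurable_sep hN))
      (fun p => habs _ _ _)
  have i2 : Integrable (Function.uncurry fun t u => sig u * (if SepEv k N t u then (1 : ℝ) else 0))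
      ((volume.restrict (Set.Ioc s 1)).prod (volume.restrict (Set.Ioc 0 s))) :=
    bdd _ _ ((measurable_sig.comp measurable_snd).mul (measurable_sep hN))
      (fun p => habs _ _ _)
  rw [e1, e2, integral_integral_swap i1, neg_add_eq_sub, sub_nonneg]
  refine integral_mono_ae i1.integral_prod_right i2.integral_prod_left ?_
  filter_upwards [ae_restrict_mem measurableSet_Ioc] with t ht
  have b1 : ∀ f : ℝ → ℝ, Measurable f → (∀ p, |f p| ≤ 1) →
      Integrable f (volume.restrict (Set.Ioc 0 s)) := fun f hf hb =>
    Integrable.of_bound hf.aestronglyMeasurable 1 (Filter.Eventually.of_forall hb)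
  refine integral_mono_ae (b1 _ ?_ fun u => habs _ _ _) (b1 _ ?_ fun u => habs _ _ _) ?_
  · exact measurable_const.mul ((measurable_sep hN).comp measurable_prodMk_right)
  · exact measurable_sig.mul ((measurable_sep hN).comp measurable_prodMk_left)
  filter_upwards [ae_restrict_mem measurableSet_Ioc] with u hu
  simp only [sep_comm (t := u) (u := t)]
  refine mul_le_mul_of_nonneg_right (sig_anti (hu.2.trans ht.1.le)) ?_
  split_ifs <;> simp

lemma pcd_sp {k : ℕ} (hk : 1 ≤ k) (b : Fin (2 * k + 1) → Cyc) (i : Fin (2 * k + 1)) (v : Cyc) :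
    pcd b (fun x => dist (b i) x) ≤ pcd (Function.update b i v) (fun x => dist (b i) x) := by
  set b' := Function.update b i v with hb'
  set y : Fin (2 * k + 1) → ℝ := fun j => fr (b j - b i) with hy
  set y' : Fin (2 * k + 1) → ℝ := fun j => fr (b' j - b i) with hy'
  have heq : ∀ j, j ≠ i → y' j = y j := fun j hj => by
    simp only [hy, hy', hb', Function.update_of_ne hj]
  have hyi : y i = 0 := by
    simp only [hy, sub_self]
    simpa using fr_coe (x := 0) le_rfl one_pos
  rcases (fr_nonneg (b' i - b i)).eq_or_lt with hs | hs
  · have : b' i = b i := by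
      have h := coe_fr (b' i - b i)
      rw [← hs] at h
      exact sub_eq_zero.1 (by simpa using h.symm)
    have : b' = b := by
      ext j
      by_cases hj : j = i
      · rw [hj, this]
      · rw [hb', Function.update_of_ne hj]
    rw [this]
  rw [← sub_nonneg, pcd_eq b _ (b i), pcd_eq b' _ (b i),
    ← intervalIntegral.integral_sub (pcd_ii _ _ _ _ _) (pcd_ii _ _ _ _ _)]
  have hd : ∀ x : Cyc, dist (b i) x = ‖x - b i‖ := fun x => by rw [dist_comm, dist_eq_norm]
  refine exchange (k := k) (N := cntN y i) (cntN_mono y i).measurable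
    (s := y' i) hs.le (fr_lt_one _).le
    (fun x z => (pcd_ii b' (fun x => dist (b i) x) (b i) x z).sub
      (pcd_ii b (fun x => dist (b i) x) (b i) x z)) ?_ ?_
  · intro t h1 h2
    obtain ⟨m, hm, em⟩ := idx_coord b (b i) (hs.trans h1) h2
    obtain ⟨m', hm', em'⟩ := idx_coord b' (b i) (hs.trans h1) h2
    rw [hd, hd, em, em']
    exact cut_right hk heq (fun j => fr_lt_one _) hyi hs h1 h2 hm hm'
  · intro t h1 h2
    have h3 : t < 1 := h2.trans (fr_lt_one _)
    obtain ⟨m, hm, em⟩ := idx_coord b (b i) h1 h3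
    obtain ⟨m', hm', em'⟩ := idx_coord b' (b i) h1 h3
    rw [hd, hd, em, em']
    exact cut_left hk heq (fun j => fr_nonneg _) hyi h1 h2 (fr_lt_one _) hm hm'

lemma mech_sp {k : ℕ} (hk : 1 ≤ k) : Strategyproof (mech (k := k)) := by
  intro b i v
  rw [cost_mech, cost_mech]
  refine add_le_add ?_ (mul_le_mul_of_nonneg_left (pcd_sp hk b i v) (by norm_num))
  refine mul_le_mul_of_nonneg_left (mul_le_mul_of_nonneg_left ?_ (by positivity)) (by norm_num)
  refine Finset.sum_le_sum fun j _ => ?_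
  by_cases hj : j = i
  · subst hj; simp
  · rw [Function.update_of_ne hj]

/-! ### Approximation -/

/-- Indicator that an agent at `y` on the right half is beyond `t`. -/
def al (y t : ℝ) : ℝ := if t ≤ y ∧ y < 1 / 2 then 1 else 0

/-- Indicator that an agent at `y` on the left half is beyond `1 - s`. -/
def be (y s : ℝ) : ℝ := if 1 / 2 ≤ y ∧ y < 1 - s then 1 else 0

lemma measurable_al (y : ℝ) : Measurable (al y) :=
  Measurable.ite (measurableSet_Iic.inter (MeasurableSet.const _)) measurable_const
    measurable_const

lemma measurable_be (y : ℝ) : Measurable (be y) :=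
  Measurable.ite ((MeasurableSet.const _).inter
    (measurableSet_lt measurable_const (measurable_const.sub measurable_id))) measurable_const
    measurable_const

lemma al_mem (y t : ℝ) : 0 ≤ al y t ∧ al y t ≤ 1 := by
  unfold al; split_ifs <;> simp

lemma be_mem (y t : ℝ) : 0 ≤ be y t ∧ be y t ≤ 1 := by
  unfold be; split_ifs <;> simp

lemma ii_of_bdd {f : ℝ → ℝ} (hf : Measurable f) {C : ℝ} (h : ∀ x, |f x| ≤ C) (a b : ℝ) :
    IntervalIntegrable f volume a b := by
  refine (intervalIntegrable_const (c := C)).mono_fun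
    hf.aestronglyMeasurable (Filter.Eventually.of_forall fun u => ?_)
  exact (h u).trans (le_abs_self C)

lemma ii_al (y a b : ℝ) : IntervalIntegrable (al y) volume a b :=
  ii_of_bdd (measurable_al y) (C := 1)
    (fun x => abs_le.2 ⟨by linarith [(al_mem y x).1], (al_mem y x).2⟩) a b

lemma ii_be (y a b : ℝ) : IntervalIntegrable (be y) volume a b :=
  ii_of_bdd (measurable_be y) (C := 1)
    (fun x => abs_le.2 ⟨by linarith [(be_mem y x).1], (be_mem y x).2⟩) a b

lemma integral_step {f : ℝ → ℝ} {a d : ℝ} (ha : 0 ≤ a) (hd : 0 ≤ d)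
    (h1 : ∀ t, t < a → f t = 1) (h2 : ∀ t, a < t → f t = 0) :
    ∫ t in (0 : ℝ)..d, f t = min a d := by
  have hne : ∀ c : ℝ, ∀ᵐ u : ℝ, u ≠ c := fun c => by simp [ae_iff]
  have h0m : 0 ≤ min a d := le_min ha hd
  rw [intervalIntegral.integral_of_le hd]
  have : ∫ t in Set.Ioc 0 d, f t =
      ∫ t in Set.Ioc 0 d, (Set.Ioc 0 (min a d)).indicator (fun _ => (1 : ℝ)) t := by
    refine setIntegral_congr_ae measurableSet_Ioc ?_
    filter_upwards [hne a] with u hu hm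
    rcases lt_or_gt_of_ne hu with h | h
    · rw [h1 u h, Set.indicator_of_mem]
      exact ⟨hm.1, le_min h.le hm.2⟩
    · rw [h2 u h, Set.indicator_of_notMem]
      exact fun hc => absurd (hc.2.trans (min_le_left _ _)) (not_le.2 h)
  rw [this, setIntegral_indicator measurableSet_Ioc,
    Set.inter_eq_right.2 (Set.Ioc_subset_Ioc le_rfl (min_le_right _ _)),
    ← intervalIntegral.integral_of_le h0m]
  simp

lemma integral_al {y d : ℝ} (hy : 0 ≤ y) (hd : 0 ≤ d) :
    ∫ t in (0 : ℝ)..d, al y t = if y < 1 / 2 then min y d else 0 := by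
  split_ifs with h
  · refine integral_step hy hd (fun t ht => ?_) (fun t ht => ?_)
    · unfold al; rw [if_pos ⟨ht.le, h⟩]
    · unfold al; rw [if_neg fun hc => absurd hc.1 (not_le.2 ht)]
  · have : al y = fun _ => 0 := by
      ext t; unfold al; rw [if_neg fun hc => h hc.2]
    simp [this]

lemma integral_be {y d : ℝ} (hy : y ≤ 1) (hd : 0 ≤ d) :
    ∫ t in (0 : ℝ)..d, be y t = if y < 1 / 2 then 0 else min (1 - y) d := by
  split_ifs with h
  · have : be y = fun _ => 0 := by
      ext t; unfold be; rw [if_neg fun hc => absurd hc.1 (not_le.2 h)]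
    simp [this]
  · refine integral_step (by linarith) hd (fun t ht => ?_) (fun t ht => ?_)
    · unfold be; rw [if_pos ⟨not_lt.1 h, by linarith⟩]
    · unfold be; rw [if_neg fun hc => by linarith [hc.2]]

lemma al_mul (y z : ℝ) :
    (fun t => al y t * al z t) = if y < 1 / 2 ∧ z < 1 / 2 then al (min y z) else fun _ => 0 := by
  ext t
  split_ifs with h
  · have h3 : min y z < 1 / 2 := (min_le_left _ _).trans_lt h.1
    by_cases h1 : t ≤ y
    · by_cases h2 : t ≤ z
      · unfold al
        rw [if_pos ⟨h1, h.1⟩, if_pos ⟨h2, h.2⟩, if_pos ⟨le_min h1 h2, h3⟩, one_mul]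
      · unfold al
        rw [if_neg fun hc : t ≤ z ∧ z < 1 / 2 => h2 hc.1,
          if_neg fun hc : t ≤ min y z ∧ min y z < 1 / 2 => h2 (hc.1.trans (min_le_right _ _)),
          mul_zero]
    · unfold al
      rw [if_neg fun hc : t ≤ y ∧ y < 1 / 2 => h1 hc.1,
        if_neg fun hc : t ≤ min y z ∧ min y z < 1 / 2 => h1 (hc.1.trans (min_le_left _ _)),
        zero_mul]
  · by_cases h1 : y < 1 / 2
    · have h2 : al z t = 0 := if_neg fun hc => h ⟨h1, hc.2⟩
      rw [h2, mul_zero]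
    · have h2 : al y t = 0 := if_neg fun hc => h1 hc.2
      rw [h2, zero_mul]

lemma be_mul (y z : ℝ) :
    (fun t => be y t * be z t) = if 1 / 2 ≤ y ∧ 1 / 2 ≤ z then be (max y z) else fun _ => 0 := by
  ext t
  split_ifs with h
  · have h3 : 1 / 2 ≤ max y z := h.1.trans (le_max_left _ _)
    by_cases h1 : y < 1 - t
    · by_cases h2 : z < 1 - t
      · unfold be
        rw [if_pos ⟨h.1, h1⟩, if_pos ⟨h.2, h2⟩, if_pos ⟨h3, max_lt h1 h2⟩, one_mul]
      · unfold be
        rw [if_neg fun hc : 1 / 2 ≤ z ∧ z < 1 - t => h2 hc.2,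
          if_neg fun hc : 1 / 2 ≤ max y z ∧ max y z < 1 - t =>
            h2 ((le_max_right _ _).trans_lt hc.2), mul_zero]
    · unfold be
      rw [if_neg fun hc : 1 / 2 ≤ y ∧ y < 1 - t => h1 hc.2,
        if_neg fun hc : 1 / 2 ≤ max y z ∧ max y z < 1 - t =>
          h1 ((le_max_left _ _).trans_lt hc.2), zero_mul]
  · by_cases h1 : 1 / 2 ≤ y
    · have h2 : be z t = 0 := if_neg fun hc => h ⟨h1, hc.1⟩
      rw [h2, mul_zero]
    · have h2 : be y t = 0 := if_neg fun hc => h1 hc.1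
      rw [h2, zero_mul]

lemma psi_eq {y : ℝ} (h0 : 0 ≤ y) (h1 : y ≤ 1) :
    psi y = (∫ t in (0 : ℝ)..(1 / 2), al y t) + ∫ t in (0 : ℝ)..(1 / 2), be y t := by
  rw [integral_al h0 (by norm_num), integral_be h1 (by norm_num)]
  unfold psi
  split_ifs with h
  · rw [min_eq_left (by linarith), min_eq_left h.le, add_zero]
  · rw [min_eq_right (by linarith), min_eq_left (by linarith), zero_add]

/-- Pairwise distances. -/
lemma pair_dist {y z : ℝ} (hy0 : 0 ≤ y) (hy1 : y ≤ 1) (hz0 : 0 ≤ z) (hz1 : z ≤ 1) :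
    ‖((y - z : ℝ) : Cyc)‖ ≤ psi y + psi z -
      2 * ((∫ t in (0 : ℝ)..(1 / 2), al y t * al z t) +
        ∫ t in (0 : ℝ)..(1 / 2), be y t * be z t) := by
  rw [al_mul, be_mul]
  have habs := norm_coe_le (y - z)
  have htri : ‖((y - z : ℝ) : Cyc)‖ ≤ psi y + psi z := by
    rw [← norm_coe hy0 hy1, ← norm_coe hz0 hz1, AddCircle.coe_sub]
    exact norm_sub_le _ _
  by_cases h1 : y < 1 / 2
  · by_cases h2 : z < 1 / 2
    · rw [if_pos ⟨h1, h2⟩, if_neg fun h => absurd h.1 (not_le.2 h1),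
        integral_al (le_min hy0 hz0) (by norm_num),
        if_pos ((min_le_left _ _).trans_lt h1), min_eq_left ((min_le_left _ _).trans h1.le)]
      unfold psi
      rw [min_eq_left (by linarith : y ≤ 1 - y), min_eq_left (by linarith : z ≤ 1 - z)]
      simp only [intervalIntegral.integral_zero, add_zero]
      rcases le_total y z with h | h
      · rw [min_eq_left h]
        rw [abs_of_nonpos (by linarith)] at habs
        linarith
      · rw [min_eq_right h]
        rw [abs_of_nonneg (by linarith)] at habs
        linarith
    · rw [if_neg fun h => h2 h.2, if_neg fun h => absurd h.1 (not_le.2 h1)]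
      simpa using htri
  · by_cases h2 : z < 1 / 2
    · rw [if_neg fun h => h1 h.1, if_neg fun h => absurd h.2 (not_le.2 h2)]
      simpa using htri
    · push Not at h1 h2
      rw [if_neg fun h => absurd h.1 (not_lt.2 h1), if_pos ⟨h1, h2⟩,
        integral_be (max_le hy1 hz1) (by norm_num),
        if_neg (not_lt.2 (h1.trans (le_max_left _ _))),
        min_eq_left (by linarith [h1.trans (le_max_left y z)])]
      unfold psi
      rw [min_eq_right (by linarith : 1 - y ≤ y), min_eq_right (by linarith : 1 - z ≤ z)]
      simp only [intervalIntegral.integral_zero, zero_add]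
      rcases le_total y z with h | h
      · rw [max_eq_right h]
        rw [abs_of_nonpos (by linarith)] at habs
        linarith
      · rw [max_eq_left h]
        rw [abs_of_nonneg (by linarith)] at habs
        linarith

/-- Moving left by `d`. -/
lemma move_left {y d : ℝ} (hy0 : 0 ≤ y) (hy1 : y ≤ 1) (hd : 0 ≤ d) :
    ‖((y + d : ℝ) : Cyc)‖ - psi y ≤ ∫ s in (0 : ℝ)..d, (1 - 2 * be y s) := by
  rw [intervalIntegral.integral_sub intervalIntegrable_const ((ii_be y 0 d).const_mul 2),
    intervalIntegral.integral_const_mul, integral_be hy1 hd]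
  simp only [intervalIntegral.integral_const, smul_eq_mul, mul_one, sub_zero]
  split_ifs with h
  · rw [← norm_coe hy0 hy1, AddCircle.coe_add]
    have h1 := norm_add_le (y : Cyc) (d : Cyc)
    have h2 := norm_coe_le d
    rw [abs_of_nonneg hd] at h2
    linarith
  · have h1 := norm_coe_le (y + d - 1)
    rw [coe_sub_one] at h1
    have h2 : psi y = 1 - y := min_eq_right (by linarith)
    rw [h2]
    rcases le_total (1 - y) d with h3 | h3
    · rw [min_eq_left h3]
      rw [abs_of_nonneg (by linarith)] at h1
      linarith
    · rw [min_eq_right h3]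
      rw [abs_of_nonpos (by linarith)] at h1
      linarith

/-- Moving right by `d`. -/
lemma move_right {y d : ℝ} (hy0 : 0 ≤ y) (hy1 : y ≤ 1) (hd : 0 ≤ d) :
    ‖((y - d : ℝ) : Cyc)‖ - psi y ≤ ∫ s in (0 : ℝ)..d, (1 - 2 * al y s) := by
  rw [intervalIntegral.integral_sub intervalIntegrable_const ((ii_al y 0 d).const_mul 2),
    intervalIntegral.integral_const_mul, integral_al hy0 hd]
  simp only [intervalIntegral.integral_const, smul_eq_mul, mul_one, sub_zero]
  split_ifs with h
  · have h1 := norm_coe_le (y - d)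
    have h2 : psi y = y := min_eq_left (by linarith)
    rw [h2]
    rcases le_total y d with h3 | h3
    · rw [min_eq_left h3]
      rw [abs_of_nonpos (by linarith)] at h1
      linarith
    · rw [min_eq_right h3]
      rw [abs_of_nonneg (by linarith)] at h1
      linarith
  · rw [← norm_coe hy0 hy1, AddCircle.coe_sub]
    have h1 := norm_sub_le (y : Cyc) (d : Cyc)
    have h2 := norm_coe_le d
    rw [abs_of_nonneg hd] at h2
    linarith

/-- Number of right agents beyond `t`. -/
def cR {n : ℕ} (y : Fin n → ℝ) (t : ℝ) : ℝ := ∑ j, al (y j) t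

/-- Number of left agents beyond `s`. -/
def cL {n : ℕ} (y : Fin n → ℝ) (s : ℝ) : ℝ := ∑ j, be (y j) s

lemma cR_eq {n : ℕ} (y : Fin n → ℝ) (t : ℝ) :
    cR y t = ((Finset.univ.filter fun j => t ≤ y j ∧ y j < 1 / 2).card : ℝ) := by
  unfold cR al; rw [Finset.sum_boole]

lemma cL_eq {n : ℕ} (y : Fin n → ℝ) (s : ℝ) :
    cL y s = ((Finset.univ.filter fun j => 1 / 2 ≤ y j ∧ y j < 1 - s).card : ℝ) := by
  unfold cL be; rw [Finset.sum_boole]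

/-- The pointwise inequality behind the ratio `7/4`. -/
lemma pointwise {k : ℕ} {c c' : ℝ} (hc : 0 ≤ c) (hc' : 0 ≤ c') :
    (if (k : ℝ) + 1 ≤ c + c' then (1 : ℝ) else 0) * (2 * k + 1 - 2 * c') +
      (if (k : ℝ) + 1 ≤ c + c' then (1 : ℝ) else 0) * (2 * k + 1 - 2 * c) ≤
    (4 / (2 * k + 1) * c ^ 2 + c) + (4 / (2 * k + 1) * c' ^ 2 + c') := by
  have hn : (0 : ℝ) < 2 * k + 1 := by positivity
  split_ifs with h
  · have h1 : c + c' ≤ 4 / (2 * k + 1) * c ^ 2 + 4 / (2 * k + 1) * c' ^ 2 := by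
      rw [← mul_add, div_mul_eq_mul_div, le_div_iff₀ hn]
      nlinarith [sq_nonneg (c - c'), mul_nonneg (add_nonneg hc hc') (sub_nonneg.2 h)]
    linarith
  · have : 0 ≤ (4 / (2 * k + 1) * c ^ 2 + c) + (4 / (2 * k + 1) * c' ^ 2 + c') := by positivity
    linarith

/-- Integrating the pointwise inequality. -/
lemma combine {k : ℕ} {c c' : ℝ → ℝ} (hc : Measurable c) (hc' : Measurable c')
    {C : ℝ} (h0 : ∀ t, 0 ≤ c t) (h0' : ∀ t, 0 ≤ c' t) (h1 : ∀ t, c t ≤ C) (h1' : ∀ t, c' t ≤ C)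
    {A B : ℝ → ℝ} (hA : IntervalIntegrable A volume 0 (1 / 2))
    (hB : IntervalIntegrable B volume 0 (1 / 2))
    (hAle : ∀ t, 0 < t → t < 1 / 2 → A t ≤ ∫ s in (0 : ℝ)..(1 / 2),
      (if (k : ℝ) + 1 ≤ c t + c' s then (1 : ℝ) else 0) * (2 * k + 1 - 2 * c' s))
    (hBle : ∀ s, 0 < s → s < 1 / 2 → B s ≤ ∫ t in (0 : ℝ)..(1 / 2),
      (if (k : ℝ) + 1 ≤ c t + c' s then (1 : ℝ) else 0) * (2 * k + 1 - 2 * c t)) :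
    (∫ t in (0 : ℝ)..(1 / 2), A t) + (∫ s in (0 : ℝ)..(1 / 2), B s) ≤
      2 / (2 * k + 1) * ((∫ t in (0 : ℝ)..(1 / 2), c t ^ 2) + ∫ t in (0 : ℝ)..(1 / 2), c' t ^ 2) +
      1 / 2 * ((∫ t in (0 : ℝ)..(1 / 2), c t) + ∫ t in (0 : ℝ)..(1 / 2), c' t) := by
  have hhalf : (0 : ℝ) ≤ 1 / 2 := by norm_num
  have hne : ∀ c : ℝ, ∀ᵐ u : ℝ, u ≠ c := fun c => by simp [ae_iff]
  simp only [intervalIntegral.integral_of_le hhalf] at hAle hBle ⊢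
  rw [intervalIntegrable_iff_integrableOn_Ioc_of_le hhalf] at hA hB
  set μ := (volume : Measure ℝ).restrict (Set.Ioc 0 (1 / 2)) with hμ
  have hμu : μ.real Set.univ = 1 / 2 := by
    simp [hμ, measureReal_def]
  set F1 : ℝ → ℝ → ℝ := fun t s =>
    (if (k : ℝ) + 1 ≤ c t + c' s then (1 : ℝ) else 0) * (2 * k + 1 - 2 * c' s) with hF1
  set F2 : ℝ → ℝ → ℝ := fun t s =>
    (if (k : ℝ) + 1 ≤ c t + c' s then (1 : ℝ) else 0) * (2 * k + 1 - 2 * c t) with hF2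
  have hE : Measurable fun p : ℝ × ℝ =>
      (if (k : ℝ) + 1 ≤ c p.1 + c' p.2 then (1 : ℝ) else 0) :=
    Measurable.ite (measurableSet_le measurable_const
      ((hc.comp measurable_fst).add (hc'.comp measurable_snd))) measurable_const measurable_const
  have hEb : ∀ (P : Prop) [Decidable P] (x : ℝ), 0 ≤ x → x ≤ C →
      ‖(if P then (1 : ℝ) else 0) * (2 * k + 1 - 2 * x)‖ ≤ 2 * k + 1 + 2 * C := by
    intro P _ x hx hxC
    have hk : (0 : ℝ) ≤ k := by positivity
    split_ifs
    · rw [one_mul, Real.norm_eq_abs, abs_le]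
      constructor <;> linarith
    · rw [zero_mul, norm_zero]; linarith
  have i1 : Integrable (Function.uncurry F1) (μ.prod μ) :=
    Integrable.of_bound (hE.mul (measurable_const.sub
      (measurable_const.mul (hc'.comp measurable_snd)))).aestronglyMeasurable (2 * k + 1 + 2 * C)
      (Filter.Eventually.of_forall fun p => hEb _ _ (h0' _) (h1' _))
  have i2 : Integrable (Function.uncurry F2) (μ.prod μ) :=
    Integrable.of_bound (hE.mul (measurable_const.sub
      (measurable_const.mul (hc.comp measurable_fst)))).aestronglyMeasurable (2 * k + 1 + 2 * C)
      (Filter.Eventually.of_forall fun p => hEb _ _ (h0 _) (h1 _))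
  have a1 : ∫ t, A t ∂μ ≤ ∫ t, ∫ s, F1 t s ∂μ ∂μ := by
    refine integral_mono_ae hA i1.integral_prod_left ?_
    filter_upwards [ae_restrict_mem measurableSet_Ioc, ae_restrict_of_ae (hne (1 / 2))] with t ht h
    exact hAle t ht.1 (lt_of_le_of_ne ht.2 h)
  have a2 : ∫ s, B s ∂μ ≤ ∫ t, ∫ s, F2 t s ∂μ ∂μ := by
    rw [integral_integral_swap i2]
    refine integral_mono_ae hB i2.integral_prod_right ?_
    filter_upwards [ae_restrict_mem measurableSet_Ioc, ae_restrict_of_ae (hne (1 / 2))] with t ht h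
    exact hBle t ht.1 (lt_of_le_of_ne ht.2 h)
  have ib : ∀ (f : ℝ → ℝ), Measurable f → ∀ D : ℝ, (∀ t, 0 ≤ f t) → (∀ t, f t ≤ D) →
      Integrable f μ := fun f hf D hf0 hfD =>
    Integrable.of_bound hf.aestronglyMeasurable D (Filter.Eventually.of_forall fun t => by
      rw [Real.norm_eq_abs, abs_of_nonneg (hf0 t)]; exact hfD t)
  have ic := ib c hc C h0 h1
  have ic' := ib c' hc' C h0' h1'
  have isq := ib (fun t => c t ^ 2) (hc.pow_const 2) (C ^ 2) (fun t => sq_nonneg _)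
    (fun t => pow_le_pow_left₀ (h0 t) (h1 t) 2)
  have isq' := ib (fun t => c' t ^ 2) (hc'.pow_const 2) (C ^ 2) (fun t => sq_nonneg _)
    (fun t => pow_le_pow_left₀ (h0' t) (h1' t) 2)
  have ig : Integrable (fun t => 4 / (2 * (k : ℝ) + 1) * c t ^ 2 + c t) μ :=
    (isq.const_mul _).add ic
  have ig' : Integrable (fun t => 4 / (2 * (k : ℝ) + 1) * c' t ^ 2 + c' t) μ :=
    (isq'.const_mul _).add ic'
  have a3 : (∫ t, ∫ s, F1 t s ∂μ ∂μ) + ∫ t, ∫ s, F2 t s ∂μ ∂μ ≤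
      ∫ t, ((1 / 2) * (4 / (2 * (k : ℝ) + 1) * c t ^ 2 + c t) +
        ∫ s, (4 / (2 * (k : ℝ) + 1) * c' s ^ 2 + c' s) ∂μ) ∂μ := by
    have j1 : Integrable (fun t => ∫ s, F1 t s ∂μ) μ := i1.integral_prod_left
    have j2 : Integrable (fun t => ∫ s, F2 t s ∂μ) μ := i2.integral_prod_left
    rw [← integral_add j1 j2]
    refine integral_mono_ae (j1.add j2)
      ((ig.const_mul _).add (integrable_const _)) ?_
    filter_upwards [i1.prod_right_ae, i2.prod_right_ae] with t ht1 ht2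
    have ht1' : Integrable (F1 t) μ := ht1
    have ht2' : Integrable (F2 t) μ := ht2
    show (∫ s, F1 t s ∂μ) + ∫ s, F2 t s ∂μ ≤ _
    have e : (1 / 2) * (4 / (2 * (k : ℝ) + 1) * c t ^ 2 + c t) =
        ∫ s, (4 / (2 * (k : ℝ) + 1) * c t ^ 2 + c t) ∂μ := by
      rw [integral_const, hμu, smul_eq_mul]
    rw [e, ← integral_add ht1' ht2', ← integral_add (integrable_const _) ig']
    refine integral_mono (ht1'.add ht2') ((integrable_const _).add ig') fun s => ?_
    exact pointwise (h0 t) (h0' s)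
  have a4 : ∫ t, ((1 / 2) * (4 / (2 * (k : ℝ) + 1) * c t ^ 2 + c t) +
        ∫ s, (4 / (2 * (k : ℝ) + 1) * c' s ^ 2 + c' s) ∂μ) ∂μ =
      2 / (2 * k + 1) * ((∫ t, c t ^ 2 ∂μ) + ∫ t, c' t ^ 2 ∂μ) +
      1 / 2 * ((∫ t, c t ∂μ) + ∫ t, c' t ∂μ) := by
    rw [integral_add (ig.const_mul _) (integrable_const _), integral_const, hμu, smul_eq_mul,
      integral_const_mul, integral_add (isq.const_mul _) ic, integral_add (isq'.const_mul _) ic',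
      integral_const_mul, integral_const_mul]
    ring
  linarith

/-! ### The optimal point -/

lemma card_le_add {n : ℕ} {p q r : Fin n → Prop} [DecidablePred p] [DecidablePred q]
    [DecidablePred r] (h : ∀ j, p j → q j ∨ r j) :
    (Finset.univ.filter p).card ≤
      (Finset.univ.filter q).card + (Finset.univ.filter r).card := by
  refine le_trans (Finset.card_le_card fun j hj => ?_) (Finset.card_union_le _ _)
  simp only [Finset.mem_union, Finset.mem_filter, Finset.mem_univ, true_and] at hj ⊢
  exact h j hj

lemma card_cover {n : ℕ} {q r : Fin n → Prop} [DecidablePred q]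
    [DecidablePred r] (h : ∀ j, q j ∨ r j) :
    n ≤ (Finset.univ.filter q).card + (Finset.univ.filter r).card := by
  have := card_le_add (p := fun _ : Fin n => True) (q := q) (r := r) fun j _ => h j
  simpa using this

lemma measurable_cR {n : ℕ} (y : Fin n → ℝ) : Measurable (cR y) :=
  Finset.measurable_sum _ fun j _ => measurable_al (y j)

lemma measurable_cL {n : ℕ} (y : Fin n → ℝ) : Measurable (cL y) :=
  Finset.measurable_sum _ fun j _ => measurable_be (y j)

lemma cR_nonneg {n : ℕ} (y : Fin n → ℝ) (t : ℝ) : 0 ≤ cR y t :=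
  Finset.sum_nonneg fun j _ => (al_mem (y j) t).1

lemma cL_nonneg {n : ℕ} (y : Fin n → ℝ) (t : ℝ) : 0 ≤ cL y t :=
  Finset.sum_nonneg fun j _ => (be_mem (y j) t).1

lemma cR_le {n : ℕ} (y : Fin n → ℝ) (t : ℝ) : cR y t ≤ n := by
  have := Finset.sum_le_sum fun j (_ : j ∈ Finset.univ) => (al_mem (y j) t).2
  simpa [cR] using this

lemma cL_le {n : ℕ} (y : Fin n → ℝ) (t : ℝ) : cL y t ≤ n := by
  have := Finset.sum_le_sum fun j (_ : j ∈ Finset.univ) => (be_mem (y j) t).2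
  simpa [cL] using this

lemma ii_lin {n : ℕ} {c : ℝ → ℝ} (hc : Measurable c) (h0 : ∀ t, 0 ≤ c t) (h1 : ∀ t, c t ≤ n)
    (a b : ℝ) : IntervalIntegrable c volume a b :=
  ii_of_bdd hc (C := n) (fun x => abs_le.2 ⟨by linarith [h0 x, h1 x], h1 x⟩) a b

/-- Distances in coordinates around `w`. -/
lemma dist_add {n : ℕ} (b : Fin n → Cyc) (w : Cyc) (x : ℝ) (j : Fin n) :
    dist (b j) (w + (x : Cyc)) = ‖((fr (b j - w) - x : ℝ) : Cyc)‖ := by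
  rw [dist_eq_norm, AddCircle.coe_sub, coe_fr]
  congr 1; abel

lemma scPt_eq {n : ℕ} (b : Fin n → Cyc) (w : Cyc) :
    scPt b w = ∑ j, psi (fr (b j - w)) := by
  refine Finset.sum_congr rfl fun j _ => ?_
  rw [← norm_coe (fr_nonneg _) (fr_lt_one _).le, coe_fr, dist_eq_norm]

lemma scPt_right {k : ℕ} (b : Fin (2 * k + 1) → Cyc) (w : Cyc) {d : ℝ} (hd : 0 ≤ d) :
    scPt b (w + (d : Cyc)) - scPt b w ≤
      ∫ s in (0 : ℝ)..d, (2 * k + 1 - 2 * cR (fun j => fr (b j - w)) s) := by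
  have e : ∀ s, 2 * (k : ℝ) + 1 - 2 * cR (fun j => fr (b j - w)) s =
      ∑ j, (1 - 2 * al (fr (b j - w)) s) := by
    intro s
    rw [Finset.sum_sub_distrib, ← Finset.mul_sum]
    simp [cR]
  simp only [e]
  rw [intervalIntegral.integral_finsetSum fun j _ =>
    intervalIntegrable_const.sub ((ii_al _ _ _).const_mul 2), scPt_eq b w, scPt,
    ← Finset.sum_sub_distrib]
  refine Finset.sum_le_sum fun j _ => ?_
  rw [dist_add]
  exact move_right (fr_nonneg _) (fr_lt_one _).le hd

lemma scPt_left {k : ℕ} (b : Fin (2 * k + 1) → Cyc) (w : Cyc) {d : ℝ} (hd : 0 ≤ d) :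
    scPt b (w + ((-d : ℝ) : Cyc)) - scPt b w ≤
      ∫ s in (0 : ℝ)..d, (2 * k + 1 - 2 * cL (fun j => fr (b j - w)) s) := by
  have e : ∀ s, 2 * (k : ℝ) + 1 - 2 * cL (fun j => fr (b j - w)) s =
      ∑ j, (1 - 2 * be (fr (b j - w)) s) := by
    intro s
    rw [Finset.sum_sub_distrib, ← Finset.mul_sum]
    simp [cL]
  simp only [e]
  rw [intervalIntegral.integral_finsetSum fun j _ =>
    intervalIntegrable_const.sub ((ii_be _ _ _).const_mul 2), scPt_eq b w, scPt,
    ← Finset.sum_sub_distrib]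
  refine Finset.sum_le_sum fun j _ => ?_
  rw [dist_add, sub_neg_eq_add]
  exact move_left (fr_nonneg _) (fr_lt_one _).le hd

lemma exists_opt {n : ℕ} (b : Fin n → Cyc) : ∃ w, ∀ x, scPt b w ≤ scPt b x := by
  have hc : Continuous (scPt b) :=
    continuous_finsetSum _ fun j _ => continuous_const.dist continuous_id
  obtain ⟨w, -, hw⟩ := (isCompact_univ (X := Cyc)).exists_isMinOn Set.univ_nonempty hc.continuousOn
  exact ⟨w, fun x => hw (Set.mem_univ x)⟩

/-- A common lower bound of finitely many positive numbers. -/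
lemma exists_small {n : ℕ} (S : Finset (Fin n)) (f : Fin n → ℝ) (h : ∀ j ∈ S, 0 < f j) :
    ∃ d, 0 < d ∧ ∀ j ∈ S, d < f j := by
  rcases S.eq_empty_or_nonempty with rfl | hne
  · exact ⟨1, one_pos, by simp⟩
  · obtain ⟨i, hi, hmin⟩ := S.exists_min_image f hne
    refine ⟨f i / 2, by linarith [h i hi], fun j hj => ?_⟩
    linarith [hmin j hj, h i hi]

lemma opt_right {k : ℕ} {b : Fin (2 * k + 1) → Cyc} {w : Cyc} (hw : ∀ x, scPt b w ≤ scPt b x) :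
    (Finset.univ.filter fun j => 0 < fr (b j - w) ∧ fr (b j - w) < 1 / 2).card ≤ k := by
  by_contra hcon
  push Not at hcon
  obtain ⟨d, hd, hdl⟩ := exists_small
    (Finset.univ.filter fun j => 0 < fr (b j - w) ∧ fr (b j - w) < 1 / 2)
    (fun j => fr (b j - w)) (fun j hj => (Finset.mem_filter.1 hj).2.1)
  have h1 := scPt_right b w hd.le
  have h2 := hw (w + (d : Cyc))
  have h3 : ∫ s in (0 : ℝ)..d, (2 * (k : ℝ) + 1 - 2 * cR (fun j => fr (b j - w)) s) ≤
      ∫ s in (0 : ℝ)..d, (-1 : ℝ) := by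
    refine intervalIntegral.integral_mono_on hd.le (intervalIntegrable_const.sub
      ((ii_lin (measurable_cR _) (cR_nonneg _) (cR_le _) _ _).const_mul 2))
      intervalIntegrable_const fun s hs => ?_
    have : k + 1 ≤ (Finset.univ.filter fun j => s ≤ fr (b j - w) ∧ fr (b j - w) < 1 / 2).card :=
      hcon.trans_le (Finset.card_le_card fun j hj => by
        have h := hdl j hj
        simp only [Finset.mem_filter, Finset.mem_univ, true_and] at hj ⊢
        exact ⟨hs.2.trans h.le, hj.2⟩)
    rw [cR_eq]
    have h' : (k : ℝ) + 1 ≤ ((Finset.univ.filter fun j =>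
      s ≤ fr (b j - w) ∧ fr (b j - w) < 1 / 2).card : ℝ) := by exact_mod_cast this
    linarith
  simp at h3
  linarith

lemma opt_left {k : ℕ} {b : Fin (2 * k + 1) → Cyc} {w : Cyc} (hw : ∀ x, scPt b w ≤ scPt b x) :
    (Finset.univ.filter fun j => 1 / 2 ≤ fr (b j - w)).card ≤ k := by
  by_contra hcon
  push Not at hcon
  obtain ⟨d, hd, hdl⟩ := exists_small (Finset.univ.filter fun j => 1 / 2 ≤ fr (b j - w))
    (fun j => 1 - fr (b j - w)) (fun j _ => by linarith [fr_lt_one (b j - w)])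
  have h1 := scPt_left b w hd.le
  have h2 := hw (w + ((-d : ℝ) : Cyc))
  have h3 : ∫ s in (0 : ℝ)..d, (2 * (k : ℝ) + 1 - 2 * cL (fun j => fr (b j - w)) s) ≤
      ∫ s in (0 : ℝ)..d, (-1 : ℝ) := by
    refine intervalIntegral.integral_mono_on hd.le (intervalIntegrable_const.sub
      ((ii_lin (measurable_cL _) (cL_nonneg _) (cL_le _) _ _).const_mul 2))
      intervalIntegrable_const fun s hs => ?_
    have : k + 1 ≤
        (Finset.univ.filter fun j => 1 / 2 ≤ fr (b j - w) ∧ fr (b j - w) < 1 - s).card :=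
      hcon.trans_le (Finset.card_le_card fun j hj => by
        have h := hdl j hj
        simp only [Finset.mem_filter, Finset.mem_univ, true_and] at hj ⊢
        exact ⟨hj, by linarith [hs.2]⟩)
    rw [cL_eq]
    have h' : (k : ℝ) + 1 ≤ ((Finset.univ.filter fun j =>
      1 / 2 ≤ fr (b j - w) ∧ fr (b j - w) < 1 - s).card : ℝ) := by exact_mod_cast this
    linarith
  simp at h3
  linarith

/-- Extending an integral using nonnegativity. -/
lemma ext_int {k n : ℕ} {c : ℝ → ℝ} (p : ℝ → Prop) [DecidablePred p] (hp : MeasurableSet {s | p s})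
    (hc : Measurable c) (h0 : ∀ t, 0 ≤ c t) (h1 : ∀ t, c t ≤ n) (hk : ∀ s, 0 < s → c s ≤ k)
    {δ : ℝ} (hδ0 : 0 ≤ δ) (hδ : δ ≤ 1 / 2) (hE : ∀ s, 0 < s → s < δ → p s) :
    ∫ s in (0 : ℝ)..δ, (2 * k + 1 - 2 * c s) ≤
      ∫ s in (0 : ℝ)..(1 / 2), (if p s then (1 : ℝ) else 0) * (2 * k + 1 - 2 * c s) := by
  have hm : Measurable fun s => (if p s then (1 : ℝ) else 0) * (2 * k + 1 - 2 * c s) :=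
    (Measurable.ite hp measurable_const measurable_const).mul
      (measurable_const.sub (measurable_const.mul hc))
  have hb : ∀ s, |(if p s then (1 : ℝ) else 0) * (2 * k + 1 - 2 * c s)| ≤ 2 * k + 1 + 2 * n := by
    intro s
    have hk : (0 : ℝ) ≤ k := by positivity
    have := h0 s
    have := h1 s
    split_ifs
    · rw [one_mul, abs_le]
      constructor <;> linarith
    · rw [zero_mul, abs_zero]; linarith
  have hi := fun x y => ii_of_bdd hm hb x y
  rw [← intervalIntegral.integral_add_adjacent_intervals (hi 0 δ) (hi δ (1 / 2))]
  have e1 : ∫ s in (0 : ℝ)..δ, (2 * k + 1 - 2 * c s) =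
      ∫ s in (0 : ℝ)..δ, (if p s then (1 : ℝ) else 0) * (2 * k + 1 - 2 * c s) := by
    refine intervalIntegral.integral_congr_ae ?_
    have hne : ∀ᵐ u : ℝ, u ≠ δ := by simp [ae_iff]
    filter_upwards [hne] with u hu h
    rw [Set.uIoc_of_le hδ0] at h
    rw [if_pos (hE u h.1 (lt_of_le_of_ne h.2 hu)), one_mul]
  have e2 : 0 ≤ ∫ s in δ..(1 / 2), (if p s then (1 : ℝ) else 0) * (2 * k + 1 - 2 * c s) := by
    rw [intervalIntegral.integral_of_le hδ]
    refine setIntegral_nonneg measurableSet_Ioc fun s hs => ?_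
    have := hk s (hδ0.trans_lt hs.1)
    have hkk : (0 : ℝ) ≤ k := by positivity
    exact mul_nonneg (by split_ifs <;> norm_num) (by linarith)
  linarith

lemma med_A {k : ℕ} {b : Fin (2 * k + 1) → Cyc} {w : Cyc} (hw : ∀ x, scPt b w ≤ scPt b x)
    {t : ℝ} (ht0 : 0 < t) (ht : t < 1 / 2) :
    scPt b (b (idx b (w + (t : Cyc)))) - scPt b w ≤ ∫ s in (0 : ℝ)..(1 / 2),
      (if (k : ℝ) + 1 ≤ cR (fun j => fr (b j - w)) t + cL (fun j => fr (b j - w)) s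
        then (1 : ℝ) else 0) * (2 * k + 1 - 2 * cL (fun j => fr (b j - w)) s) := by
  have hR := opt_right hw
  have hL := opt_left hw
  obtain ⟨m, ⟨hm1, hm2⟩, hb⟩ := idx_coord b w ht0 (by linarith)
  have hy0 : ∀ j, 0 ≤ fr (b j - w) := fun j => fr_nonneg _
  have hy1 : ∀ j, fr (b j - w) < 1 := fun j => fr_lt_one _
  have hb' : b (idx b (w + (t : Cyc))) = w + ((-(-m) : ℝ) : Cyc) := by
    rw [neg_neg, ← hb]; abel
  rw [hb']
  generalize hy : (fun j => fr (b j - w)) = y at *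
  have hyj : ∀ j, fr (b j - w) = y j := fun j => congrFun hy j
  simp only [hyj] at hR hL hy0 hy1
  have hm0 : m ≤ 0 := by
    by_contra hc
    push Not at hc
    have := card_cover (q := fun j => zf y t j < m) (r := fun j => 0 < y j ∧ y j < 1 / 2)
      (fun j => by
        unfold zf
        have := hy0 j
        have := hy1 j
        split_ifs with h
        · rcases (hy0 j).eq_or_lt with h0 | h0
          · left; linarith
          · right; exact ⟨h0, by linarith⟩
        · left; linarith)
    omega
  have hm5 : -(1 / 2) ≤ m := by
    by_contra hc
    push Not at hc
    have := card_mono (p := fun j => zf y t j ≤ m) (q := fun j => 0 < y j ∧ y j < 1 / 2)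
      (fun j hj => by
        unfold zf at hj
        have := hy0 j
        split_ifs at hj with h
        · linarith
        · constructor <;> linarith)
    omega
  refine (scPt_left b w (d := -m) (by linarith)).trans ?_
  rw [hy]
  refine ext_int (fun s => (k : ℝ) + 1 ≤ cR y t + cL y s)
    (measurableSet_le measurable_const (measurable_const.add (measurable_cL y))) (measurable_cL y)
    (cL_nonneg y) (cL_le y) (fun s hs => ?_) (by linarith) (by linarith) fun s hs0 hs => ?_
  · rw [cL_eq]
    have h := (card_mono (p := fun j => 1 / 2 ≤ y j ∧ y j < 1 - s) (q := fun j => 1 / 2 ≤ y j)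
      fun j hj => hj.1).trans hL
    exact_mod_cast h
  · rw [cL_eq, cR_eq]
    have := card_le_add (p := fun j => zf y t j ≤ m) (q := fun j => t ≤ y j ∧ y j < 1 / 2)
      (r := fun j => 1 / 2 ≤ y j ∧ y j < 1 - s) (fun j hj => by
        unfold zf at hj
        have := hy0 j
        split_ifs at hj with h
        · linarith
        · rcases lt_or_ge (y j) (1 / 2) with h5 | h5
          · exact Or.inl ⟨not_lt.1 h, h5⟩
          · exact Or.inr ⟨h5, by linarith⟩)
    exact_mod_cast hm2.trans this

lemma med_B {k : ℕ} {b : Fin (2 * k + 1) → Cyc} {w : Cyc} (hw : ∀ x, scPt b w ≤ scPt b x)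
    {s : ℝ} (hs0 : 0 < s) (hs : s < 1 / 2) :
    scPt b (b (idx b (w + ((1 - s : ℝ) : Cyc)))) - scPt b w ≤ ∫ t in (0 : ℝ)..(1 / 2),
      (if (k : ℝ) + 1 ≤ cR (fun j => fr (b j - w)) t + cL (fun j => fr (b j - w)) s
        then (1 : ℝ) else 0) * (2 * k + 1 - 2 * cR (fun j => fr (b j - w)) t) := by
  have hR := opt_right hw
  have hL := opt_left hw
  obtain ⟨m, ⟨hm1, hm2⟩, hb⟩ := idx_coord b w (t := 1 - s) (by linarith) (by linarith)
  have hy0 : ∀ j, 0 ≤ fr (b j - w) := fun j => fr_nonneg _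
  have hy1 : ∀ j, fr (b j - w) < 1 := fun j => fr_lt_one _
  have hb' : b (idx b (w + ((1 - s : ℝ) : Cyc))) = w + (m : Cyc) := by
    rw [← hb]; abel
  rw [hb']
  generalize hy : (fun j => fr (b j - w)) = y at *
  have hyj : ∀ j, fr (b j - w) = y j := fun j => congrFun hy j
  simp only [hyj] at hR hL hy0 hy1
  have hm0 : 0 ≤ m := by
    by_contra hc
    push Not at hc
    have := card_mono (p := fun j => zf y (1 - s) j ≤ m) (q := fun j => 1 / 2 ≤ y j)
      (fun j hj => by
        unfold zf at hj
        have := hy0 j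
        split_ifs at hj with h
        · linarith
        · linarith)
    omega
  have hm5 : m ≤ 1 / 2 := by
    by_contra hc
    push Not at hc
    have := card_cover (q := fun j => zf y (1 - s) j < m) (r := fun j => 1 / 2 ≤ y j)
      (fun j => by
        unfold zf
        have := hy0 j
        have := hy1 j
        rcases lt_or_ge (y j) (1 / 2) with h5 | h5
        · left
          split_ifs with h <;> linarith
        · exact Or.inr h5)
    omega
  refine (scPt_right b w hm0).trans ?_
  rw [hy]
  refine ext_int (fun t => (k : ℝ) + 1 ≤ cR y t + cL y s)
    (measurableSet_le measurable_const ((measurable_cR y).add measurable_const)) (measurable_cR y)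
    (cR_nonneg y) (cR_le y) (fun t ht => ?_) hm0 hm5 fun t ht0 ht => ?_
  · rw [cR_eq]
    have h := (card_mono (p := fun j => t ≤ y j ∧ y j < 1 / 2)
      (q := fun j => 0 < y j ∧ y j < 1 / 2) fun j hj => ⟨ht.trans_le hj.1, hj.2⟩).trans hR
    exact_mod_cast h
  · rw [cL_eq, cR_eq]
    have h1 := card_cover (q := fun j => zf y (1 - s) j < m)
      (r := fun j => t ≤ y j ∧ y j < 1 - s) (fun j => by
        unfold zf
        have := hy1 j
        split_ifs with h
        · rcases lt_or_ge (y j) t with h5 | h5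
          · left; linarith
          · exact Or.inr ⟨h5, h⟩
        · left; linarith)
    have h2 := card_le_add (p := fun j => t ≤ y j ∧ y j < 1 - s)
      (q := fun j => t ≤ y j ∧ y j < 1 / 2)
      (r := fun j => 1 / 2 ≤ y j ∧ y j < 1 - s) (fun j hj => by
        rcases lt_or_ge (y j) (1 / 2) with h5 | h5
        · exact Or.inl ⟨hj.1, h5⟩
        · exact Or.inr ⟨h5, hj.2⟩)
    have h3 : k + 1 ≤ (Finset.univ.filter fun j => t ≤ y j ∧ y j < 1 / 2).card +
      (Finset.univ.filter fun j => 1 / 2 ≤ y j ∧ y j < 1 - s).card := by omega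
    exact_mod_cast h3

lemma sum_psi {n : ℕ} (y : Fin n → ℝ) (h0 : ∀ j, 0 ≤ y j) (h1 : ∀ j, y j ≤ 1) :
    ∑ j, psi (y j) = (∫ t in (0 : ℝ)..(1 / 2), cR y t) + ∫ t in (0 : ℝ)..(1 / 2), cL y t := by
  unfold cR cL
  rw [intervalIntegral.integral_finsetSum fun j _ => ii_al _ _ _,
    intervalIntegral.integral_finsetSum fun j _ => ii_be _ _ _, ← Finset.sum_add_distrib]
  exact Finset.sum_congr rfl fun j _ => psi_eq (h0 j) (h1 j)

lemma ii_al_mul (y z a b : ℝ) : IntervalIntegrable (fun t => al y t * al z t) volume a b :=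
  ii_of_bdd ((measurable_al y).mul (measurable_al z)) (C := 1) (fun x => by
    have h1 := al_mem y x
    have h2 := al_mem z x
    refine (abs_of_nonneg (mul_nonneg h1.1 h2.1)).le.trans ?_
    exact mul_le_one₀ h1.2 h2.1 h2.2) a b

lemma ii_be_mul (y z a b : ℝ) : IntervalIntegrable (fun t => be y t * be z t) volume a b :=
  ii_of_bdd ((measurable_be y).mul (measurable_be z)) (C := 1) (fun x => by
    have h1 := be_mem y x
    have h2 := be_mem z x
    refine (abs_of_nonneg (mul_nonneg h1.1 h2.1)).le.trans ?_
    exact mul_le_one₀ h1.2 h2.1 h2.2) a b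

/-- Random dictatorship part. -/
lemma rd_bound {n : ℕ} (b : Fin n → Cyc) (w : Cyc) :
    ∑ i, ∑ j, dist (b i) (b j) ≤ 2 * n * scPt b w -
      2 * ((∫ t in (0 : ℝ)..(1 / 2), cR (fun j => fr (b j - w)) t ^ 2) +
        ∫ t in (0 : ℝ)..(1 / 2), cL (fun j => fr (b j - w)) t ^ 2) := by
  have e1 : ∫ t in (0 : ℝ)..(1 / 2), cR (fun j => fr (b j - w)) t ^ 2 =
      ∑ i, ∑ j, ∫ t in (0 : ℝ)..(1 / 2), al (fr (b i - w)) t * al (fr (b j - w)) t := by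
    simp only [cR, sq, Finset.sum_mul_sum]
    rw [intervalIntegral.integral_finsetSum]
    · refine Finset.sum_congr rfl fun i _ => ?_
      rw [intervalIntegral.integral_finsetSum fun j _ => ii_al_mul _ _ _ _]
    · intro i _
      exact ii_of_bdd (Finset.measurable_sum _ fun j _ => (measurable_al _).mul (measurable_al _))
        (C := n) (fun x => by
          refine (Finset.abs_sum_le_sum_abs _ _).trans ?_
          refine (Finset.sum_le_sum (g := fun _ => (1 : ℝ)) fun j _ => ?_).trans (by simp)
          have h1 := al_mem (fr (b i - w)) x
          have h2 := al_mem (fr (b j - w)) x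
          refine (abs_of_nonneg (mul_nonneg h1.1 h2.1)).le.trans ?_
          exact mul_le_one₀ h1.2 h2.1 h2.2) _ _
  have e2 : ∫ t in (0 : ℝ)..(1 / 2), cL (fun j => fr (b j - w)) t ^ 2 =
      ∑ i, ∑ j, ∫ t in (0 : ℝ)..(1 / 2), be (fr (b i - w)) t * be (fr (b j - w)) t := by
    simp only [cL, sq, Finset.sum_mul_sum]
    rw [intervalIntegral.integral_finsetSum]
    · refine Finset.sum_congr rfl fun i _ => ?_
      rw [intervalIntegral.integral_finsetSum fun j _ => ii_be_mul _ _ _ _]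
    · intro i _
      exact ii_of_bdd (Finset.measurable_sum _ fun j _ => (measurable_be _).mul (measurable_be _))
        (C := n) (fun x => by
          refine (Finset.abs_sum_le_sum_abs _ _).trans ?_
          refine (Finset.sum_le_sum (g := fun _ => (1 : ℝ)) fun j _ => ?_).trans (by simp)
          have h1 := be_mem (fr (b i - w)) x
          have h2 := be_mem (fr (b j - w)) x
          refine (abs_of_nonneg (mul_nonneg h1.1 h2.1)).le.trans ?_
          exact mul_le_one₀ h1.2 h2.1 h2.2) _ _
  have e3 : ∑ i, ∑ j, dist (b i) (b j) ≤ ∑ i, ∑ j, (psi (fr (b i - w)) + psi (fr (b j - w)) -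
      2 * ((∫ t in (0 : ℝ)..(1 / 2), al (fr (b i - w)) t * al (fr (b j - w)) t) +
        ∫ t in (0 : ℝ)..(1 / 2), be (fr (b i - w)) t * be (fr (b j - w)) t)) := by
    refine Finset.sum_le_sum fun i _ => Finset.sum_le_sum fun j _ => ?_
    have : dist (b i) (b j) = ‖((fr (b i - w) - fr (b j - w) : ℝ) : Cyc)‖ := by
      rw [AddCircle.coe_sub, coe_fr, coe_fr, dist_eq_norm]
      congr 1; abel
    rw [this]
    exact pair_dist (fr_nonneg _) (fr_lt_one _).le (fr_nonneg _) (fr_lt_one _).le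
  refine e3.trans (le_of_eq ?_)
  rw [e1, e2, scPt_eq]
  simp only [Finset.sum_sub_distrib, Finset.sum_add_distrib, ← Finset.mul_sum, Finset.sum_const,
    Finset.card_univ, Fintype.card_fin, nsmul_eq_mul]
  ring

lemma pcd_bound {k : ℕ} {b : Fin (2 * k + 1) → Cyc} {w : Cyc} (hw : ∀ x, scPt b w ≤ scPt b x) :
    pcd b (scPt b) - scPt b w ≤
      2 / (2 * k + 1) * ((∫ t in (0 : ℝ)..(1 / 2), cR (fun j => fr (b j - w)) t ^ 2) +
        ∫ t in (0 : ℝ)..(1 / 2), cL (fun j => fr (b j - w)) t ^ 2) + 1 / 2 * scPt b w := by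
  have hO := sum_psi (fun j => fr (b j - w)) (fun j => fr_nonneg _) (fun j => (fr_lt_one _).le)
  rw [← scPt_eq] at hO
  have iA := (pcd_ii b (scPt b) w 0 (1 / 2)).sub (intervalIntegrable_const (c := scPt b w))
  have iC := (pcd_ii b (scPt b) w (1 / 2) 1).sub (intervalIntegrable_const (c := scPt b w))
  have iB := (iC.comp_sub_left 1).symm
  norm_num only at iB
  have hcomb := combine (k := k) (measurable_cR fun j => fr (b j - w))
    (measurable_cL fun j => fr (b j - w)) (C := ((2 * k + 1 : ℕ) : ℝ)) (cR_nonneg _) (cL_nonneg _)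
    (cR_le _) (cL_le _) iA iB (fun t h0 h1 => med_A hw h0 h1) (fun s h0 h1 => med_B hw h0 h1)
  rw [← hO] at hcomb
  refine le_trans (le_of_eq ?_) hcomb
  have hsub := intervalIntegral.integral_comp_sub_left (a := 0) (b := 1 / 2)
    (fun t : ℝ => scPt b (b (idx b (w + (t : Cyc)))) - scPt b w) 1
  rw [sub_zero, show (1 : ℝ) - 1 / 2 = 1 / 2 by norm_num] at hsub
  rw [hsub, intervalIntegral.integral_add_adjacent_intervals iA iC,
    intervalIntegral.integral_sub (pcd_ii b (scPt b) w 0 1) intervalIntegrable_const, ← pcd_eq]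
  simp

lemma sum_pcd {k : ℕ} (b : Fin (2 * k + 1) → Cyc) :
    ∑ i, pcd b (fun x => dist (b i) x) = pcd b (scPt b) := by
  rw [pcd_eq b _ 0]
  simp only [scPt]
  rw [intervalIntegral.integral_finsetSum fun i _ => pcd_ii b (fun x => dist (b i) x) 0 0 1]
  exact Finset.sum_congr rfl fun i _ => pcd_eq b _ 0

lemma mech_approx {k : ℕ} (b : Fin (2 * k + 1) → Cyc) (x : Cyc) :
    scLot b (mech b) ≤ 7 / 4 * scPt b x := by
  obtain ⟨w, hw⟩ := exists_opt b
  have h1 := rd_bound b w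
  have h2 := pcd_bound hw
  have e : scLot b (mech b) = 1 / 2 * (1 / (2 * k + 1) * ∑ i, ∑ j, dist (b i) (b j)) +
      1 / 2 * pcd b (scPt b) := by
    unfold scLot
    simp only [cost_mech, Finset.sum_add_distrib, ← Finset.mul_sum]
    rw [sum_pcd]
  rw [e]
  have hn : (0 : ℝ) < 2 * k + 1 := by positivity
  push_cast at h1
  have h3 := mul_le_mul_of_nonneg_left h1 (one_div_pos.2 hn).le
  have h4 := hw x
  generalize (∫ t in (0 : ℝ)..(1 / 2), cR (fun j => fr (b j - w)) t ^ 2) +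
        ∫ t in (0 : ℝ)..(1 / 2), cL (fun j => fr (b j - w)) t ^ 2 = Q at *
  have h5 : 1 / (2 * (k : ℝ) + 1) * (2 * (2 * k + 1) * scPt b w - 2 * Q) =
      2 * scPt b w - 2 / (2 * k + 1) * Q := by
    field_simp
  linarith

/-- For every odd number of agents `n = 2k+1` there is a strategyproof mechanism whose
social cost is at most `7/4` times the social cost of any point, i.e. whose approximation
ratio is at most `7/4`. -/
theorem exists_strategyproof_approx_seven_quarters (k : ℕ) (hk : 1 ≤ k) :
    ∃ M : (Fin (2 * k + 1) → Cyc) → PMF Cyc, Strategyproof M ∧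
      ∀ (b : Fin (2 * k + 1) → Cyc) (w : Cyc),
        scLot b (M b) ≤ (7 / 4) * scPt b w :=
  ⟨mech, mech_sp hk, fun b w => mech_approx b w⟩

end
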